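/- arXiv:1107.1861 — 2 statements merged into one kernel-verified Lean document; each statement's English description precedes it below -/
import Mathlib

section
/- Let Λ be an artin algebra and M a Λ-module. If every Λ-module X satisfies M-dim X ≤ d (i.e., iterating minimal right add-M-approximations, the d-th kernel Ω_M^d(X) lies in add M), then the global dimension of End(M) is at most d + 2. -/
open CategoryTheory

universe u

section Defs
variable (Λ : Type u) [Ring Λ]

/-- A module is torsionless if it embeds into a finitely generated free
(equivalently, projective) module. -/
def Torsionless (N : Type u) [AddCommGroup N] [Module Λ N] : Prop :=
  ∃ (n : ℕ) (f : N →ₗ[Λ] (Fin n → Λ)), Function.Injective f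

/-- A module is divisible if it is a quotient of a finitely generated injective module. -/
def Divisible (N : Type u) [AddCommGroup N] [Module Λ N] : Prop :=
  ∃ (Q : ModuleCat.{u} Λ), Module.Finite Λ Q ∧ Module.Injective Λ Q ∧
    ∃ f : ↥Q →ₗ[Λ] N, Function.Surjective f

/-- An indecomposable module: nonzero, and the only idempotent endomorphisms are 0 and 1. -/
def Indec (N : Type u) [AddCommGroup N] [Module Λ N] : Prop :=
  Nontrivial N ∧ ∀ e : Module.End Λ N, e * e = e → e = 0 ∨ e = 1

/-- `N` belongs to `add M`: it is a direct summand of a finite direct sum of copies of `M`. -/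
def InAdd (M : Type u) [AddCommGroup M] [Module Λ M]
    (N : Type u) [AddCommGroup N] [Module Λ N] : Prop :=
  ∃ (n : ℕ) (i : N →ₗ[Λ] (Fin n → M)) (p : (Fin n → M) →ₗ[Λ] N),
    p.comp i = LinearMap.id

/-- `N` is cogenerated by `M`: it embeds into a finite direct sum of copies of `M`. -/
def CogenBy (M : Type u) [AddCommGroup M] [Module Λ M]
    (N : Type u) [AddCommGroup N] [Module Λ N] : Prop :=
  ∃ (n : ℕ) (f : N →ₗ[Λ] (Fin n → M)), Function.Injective f

/-- There are only finitely many isomorphism classes of indecomposable torsionless modules. -/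
def TorsionlessFinite : Prop :=
  ∃ (n : ℕ) (L : Fin n → ModuleCat.{u} Λ),
    ∀ N : ModuleCat.{u} Λ, Module.Finite Λ N → Torsionless Λ N → Indec Λ N →
      ∃ i, Nonempty (N ≃ₗ[Λ] L i)

/-- The algebra is representation-finite. -/
def RepFinite : Prop :=
  ∃ (n : ℕ) (L : Fin n → ModuleCat.{u} Λ),
    ∀ N : ModuleCat.{u} Λ, Module.Finite Λ N → Indec Λ N →
      ∃ i, Nonempty (N ≃ₗ[Λ] L i)

/-- `M` has a projective resolution of length at most `d` by finitely generated projectives. -/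
def ProjDimLE : ℕ → ModuleCat.{u} Λ → Prop
  | 0, M => Module.Projective Λ M
  | (d+1), M => ∃ (P : ModuleCat.{u} Λ) (f : ↥P →ₗ[Λ] ↥M),
      Module.Projective Λ P ∧ Module.Finite Λ P ∧ Function.Surjective f ∧
      ProjDimLE d (ModuleCat.of Λ ↥(LinearMap.ker f))

/-- The global dimension of `Λ` is at most `d`. -/
def GlobalDimLE (d : ℕ) : Prop :=
  ∀ M : ModuleCat.{u} Λ, Module.Finite Λ M → ProjDimLE Λ d M

/-- `M` is a generator-cogenerator: every finitely generated projective and every finitely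
generated injective module lies in `add M`. -/
def IsGenCogen (M : Type u) [AddCommGroup M] [Module Λ M] : Prop :=
  Module.Finite Λ M ∧
  (∀ P : ModuleCat.{u} Λ, Module.Finite Λ P → Module.Projective Λ P → InAdd Λ M ↥P) ∧
  (∀ Q : ModuleCat.{u} Λ, Module.Finite Λ Q → Module.Injective Λ Q → InAdd Λ M ↥Q)

/-- The representation dimension of `Λ` is at most `d`. -/
def RepDimLE (d : ℕ) : Prop :=
  ∃ M : ModuleCat.{u} Λ, IsGenCogen Λ ↥M ∧ GlobalDimLE (Module.End Λ ↥M) d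

end Defs

section Auslander

variable (Λ : Type u) [Ring Λ]

/-- `g : M' → X` is a right `add M`-approximation of `X`. -/
def IsRightAddApprox (M M' X : ModuleCat.{u} Λ) (g : ↥M' →ₗ[Λ] ↥X) : Prop :=
  InAdd Λ ↥M ↥M' ∧ ∀ φ : ↥M →ₗ[Λ] ↥X, ∃ ψ : ↥M →ₗ[Λ] ↥M', g.comp ψ = φ

/-- `g : M' → X` is a minimal right `add M`-approximation of `X`. -/
def IsMinRightAddApprox (M M' X : ModuleCat.{u} Λ) (g : ↥M' →ₗ[Λ] ↥X) : Prop :=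
  IsRightAddApprox Λ M M' X g ∧
    ∀ h : ↥M' →ₗ[Λ] ↥M', g.comp h = g → Function.Bijective h

/-- `M`-dimension of `X` is at most `d`: iterating kernels of minimal right
`add M`-approximations `d` times lands in `add M`. -/
def MDimLE (M : ModuleCat.{u} Λ) : ℕ → ModuleCat.{u} Λ → Prop
  | 0, X => InAdd Λ ↥M ↥X
  | (d+1), X => ∃ (M' : ModuleCat.{u} Λ) (g : ↥M' →ₗ[Λ] ↥X),
      IsMinRightAddApprox Λ M M' X g ∧
      MDimLE M d (ModuleCat.of Λ ↥(LinearMap.ker g))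

end Auslander

section HomDual

/-- A character of `A` killing the kernel of `p : A → B` factors through `p`. -/
lemma exists_character_comp_eq {A B : Type*} [AddCommGroup A] [AddCommGroup B] (p : A →+ B)
    (f : CharacterModule A) (hf : ∀ a, p a = 0 → f a = 0) :
    ∃ h : CharacterModule B, ∀ a, h (p a) = f a := by
  obtain ⟨h, hh⟩ := CharacterModule.dual_surjective_of_injective (R := ℤ)
    (p.range.subtype.toIntLinearMap) p.range.subtype_injective
    ((QuotientAddGroup.lift p.ker f hf).comp
      (QuotientAddGroup.quotientKerEquivRange p).symm.toAddMonoidHom)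
  refine ⟨h, fun a ↦ ?_⟩
  have key : (QuotientAddGroup.quotientKerEquivRange p).symm ⟨p a, a, rfl⟩ =
      (QuotientAddGroup.mk a : A ⧸ p.ker) := by
    rw [AddEquiv.symm_apply_eq]
    rfl
  have := DFunLike.congr_fun hh ⟨p a, a, rfl⟩
  refine this.trans ?_
  change QuotientAddGroup.lift p.ker f hf
    ((QuotientAddGroup.quotientKerEquivRange p).symm ⟨p a, a, rfl⟩) = f a
  rw [key]
  rfl

/-- An element on which every character killing the range of `p` vanishes lies in that range. -/
lemma exists_eq_of_forall_character {A B : Type*} [AddCommGroup A] [AddCommGroup B] (p : A →+ B)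
    (b : B) (hb : ∀ χ : CharacterModule B, (∀ a, χ (p a) = 0) → χ b = 0) : ∃ a, p a = b := by
  have : (QuotientAddGroup.mk b : B ⧸ p.range) = 0 := by
    refine CharacterModule.eq_zero_of_character_apply fun c ↦ ?_
    refine hb (AddMonoidHom.comp c (QuotientAddGroup.mk' p.range)) fun a ↦ ?_
    change c (QuotientAddGroup.mk (p a)) = 0
    rw [(QuotientAddGroup.eq_zero_iff _).2 (AddMonoidHom.mem_range.2 ⟨a, rfl⟩), map_zero]
  exact (QuotientAddGroup.eq_zero_iff _).1 this

variable {Λ : Type*} [Ring Λ] {M : Type*} [AddCommGroup M] [Module Λ M]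
variable {X Y : Type*} [AddCommGroup X] [Module Λ X] [AddCommGroup Y] [Module Λ Y]

/-- The characters of the right `End M`-module `Hom(M, Y)` form a left `End M`-module. -/
instance CharacterModule.homModule :
    Module (Module.End Λ M) (CharacterModule (M →ₗ[Λ] Y)) where
  smul e f := AddMonoidHom.comp f (LinearMap.lcomp ℤ Y e).toAddMonoidHom
  one_smul _ := rfl
  mul_smul _ _ _ := rfl
  smul_zero _ := rfl
  smul_add _ _ _ := rfl
  add_smul e₁ e₂ f := by
    ext φ
    change f (φ ∘ₗ (e₁ + e₂)) = f (φ ∘ₗ e₁) + f (φ ∘ₗ e₂)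
    rw [LinearMap.comp_add, map_add]
  zero_smul f := by
    ext φ
    change f (φ ∘ₗ 0) = 0
    rw [LinearMap.comp_zero, map_zero]

lemma CharacterModule.hom_smul_apply (e : Module.End Λ M) (f : CharacterModule (M →ₗ[Λ] Y))
    (φ : M →ₗ[Λ] Y) : (e • f) φ = f (φ ∘ₗ e) := rfl

variable (M) in
/-- The map of characters induced by composition with `g : X → Y`. -/
def homDualMap (g : X →ₗ[Λ] Y) :
    CharacterModule (M →ₗ[Λ] Y) →ₗ[Module.End Λ M] CharacterModule (M →ₗ[Λ] X) where
  toFun f := AddMonoidHom.comp f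
    (AddMonoidHom.mk' (fun φ : M →ₗ[Λ] X ↦ g ∘ₗ φ) fun _ _ ↦ LinearMap.comp_add _ _ _)
  map_add' _ _ := rfl
  map_smul' _ _ := rfl

lemma homDualMap_apply (g : X →ₗ[Λ] Y) (f : CharacterModule (M →ₗ[Λ] Y)) (φ : M →ₗ[Λ] X) :
    homDualMap M g f φ = f (g ∘ₗ φ) := rfl

lemma homDualMap_injective (g : X →ₗ[Λ] Y) (hg : ∀ φ : M →ₗ[Λ] Y, ∃ ψ : M →ₗ[Λ] X, g ∘ₗ ψ = φ) :
    Function.Injective (homDualMap M g) := by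
  intro f₁ f₂ h
  ext φ
  obtain ⟨ψ, rfl⟩ := hg φ
  exact DFunLike.congr_fun h ψ

lemma homDualMap_exact (g : X →ₗ[Λ] Y) :
    Function.Exact (homDualMap M g) (homDualMap M (LinearMap.ker g).subtype) := by
  intro f
  constructor
  · intro hf
    refine (exists_character_comp_eq
      (AddMonoidHom.mk' (fun φ : M →ₗ[Λ] X ↦ g ∘ₗ φ) fun _ _ ↦ LinearMap.comp_add _ _ _) f
      fun φ hφ ↦ ?_).imp fun h hh ↦ CharacterModule.ext _ hh
    have := DFunLike.congr_fun hf
      (φ.codRestrict (LinearMap.ker g) fun m ↦ DFunLike.congr_fun hφ m)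
    simpa [homDualMap_apply] using! this
  · rintro ⟨h, rfl⟩
    ext φ
    rw [homDualMap_apply, homDualMap_apply, ← LinearMap.comp_assoc]
    have : g ∘ₗ (LinearMap.ker g).subtype = 0 := by ext x; exact x.2
    rw [this, LinearMap.zero_comp, map_zero]
    rfl

lemma homDualMap_surjective (g : X →ₗ[Λ] Y) (hg : Function.Injective g) :
    Function.Surjective (homDualMap M g) := by
  intro f
  refine (exists_character_comp_eq
    (AddMonoidHom.mk' (fun φ : M →ₗ[Λ] X ↦ g ∘ₗ φ) fun _ _ ↦ LinearMap.comp_add _ _ _) f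
    fun φ hφ ↦ ?_).imp fun h hh ↦ CharacterModule.ext _ hh
  have : φ = 0 := by
    ext m
    exact hg ((DFunLike.congr_fun hφ m).trans (map_zero g).symm)
  rw [this, map_zero]

/-- The character module of `Hom(M, Y)` is injective over `End M` when `Y` lies in `add M`. -/
lemma injective_homDual_of_inAdd {Λ : Type u} [Ring Λ] {M Y : Type u} [AddCommGroup M]
    [Module Λ M] [AddCommGroup Y] [Module Λ Y] (h : InAdd Λ M Y) :
    Module.Injective (Module.End Λ M) (CharacterModule (M →ₗ[Λ] Y)) := by
  classical
  obtain ⟨n, i, p, hpi⟩ := h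
  refine ⟨fun L L' _ _ _ _ f hf u ↦ ?_⟩
  let a : Fin n → (M →ₗ[Λ] Y) := fun j ↦ p ∘ₗ LinearMap.single Λ (fun _ ↦ M) j
  have hc : ∀ j, ∃ c : CharacterModule L', ∀ l, c (f l) = u l (a j) := fun j ↦
    exists_character_comp_eq f.toAddMonoidHom
      (AddMonoidHom.mk' (fun l ↦ u l (a j)) fun x y ↦ by rw [map_add]; rfl)
      fun l hl ↦ by
        have : l = 0 := hf (hl.trans (map_zero f).symm)
        rw [this]
        exact congrArg (fun z : CharacterModule (M →ₗ[Λ] Y) ↦ z (a j)) (map_zero u)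
  choose c hc using hc
  let b : (M →ₗ[Λ] Y) → Fin n → Module.End Λ M := fun φ j ↦ LinearMap.proj j ∘ₗ i ∘ₗ φ
  have b_add : ∀ φ ψ j, b (φ + ψ) j = b φ j + b ψ j := fun φ ψ j ↦ by
    simp only [b, LinearMap.comp_add]
  let v : L' →ₗ[Module.End Λ M] CharacterModule (M →ₗ[Λ] Y) :=
    { toFun := fun l ↦ AddMonoidHom.mk' (fun φ ↦ ∑ j, c j (b φ j • l)) fun φ ψ ↦ by
        simp only [b_add, add_smul, map_add, Finset.sum_add_distrib]
      map_add' := fun x y ↦ by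
        ext φ
        change ∑ j, c j (b φ j • (x + y)) = ∑ j, c j (b φ j • x) + ∑ j, c j (b φ j • y)
        simp only [smul_add, map_add, Finset.sum_add_distrib]
      map_smul' := fun e x ↦ by
        ext φ
        change ∑ j, c j (b φ j • (e • x)) = ∑ j, c j (b (φ ∘ₗ e) j • x)
        simp only [smul_smul]
        rfl }
  refine ⟨v, fun l ↦ ?_⟩
  ext φ
  change ∑ j, c j (b φ j • f l) = u l φ
  have : ∑ j, a j ∘ₗ b φ j = φ := by
    ext m
    have h1 := DFunLike.congr_fun hpi (φ m)
    simp only [LinearMap.comp_apply, LinearMap.id_apply] at h1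
    conv_rhs => rw [← h1, ← Finset.univ_sum_single (i (φ m)), map_sum]
    simp [a, b]
  conv_rhs => rw [← this, map_sum]
  refine Finset.sum_congr rfl fun j _ ↦ ?_
  rw [← map_smul, hc, map_smul, CharacterModule.hom_smul_apply]

end HomDual

section InjectiveDimension

lemma hasInjectiveDimensionLT_of_exact {R : Type u} [Ring R] {A B C : Type u} [AddCommGroup A]
    [Module R A] [AddCommGroup B] [Module R B] [AddCommGroup C] [Module R C]
    (f : A →ₗ[R] B) (g : B →ₗ[R] C) (hf : Function.Injective f) (hfg : Function.Exact f g)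
    (hg : Function.Surjective g) (hB : Module.Injective R B) (n : ℕ)
    (hC : HasInjectiveDimensionLT (ModuleCat.of R C) n) :
    HasInjectiveDimensionLT (ModuleCat.of R A) (n + 1) := by
  let S : ShortComplex (ModuleCat.{u} R) :=
    ShortComplex.mk (ModuleCat.ofHom f) (ModuleCat.ofHom g) (by
      ext x; exact (hfg (f x)).2 ⟨x, rfl⟩)
  have hS : S.ShortExact :=
    { exact := (ShortComplex.ShortExact.moduleCat_exact_iff_function_exact S).2 hfg
      mono_f := (ModuleCat.mono_iff_injective _).2 hf
      epi_g := (ModuleCat.epi_iff_surjective _).2 hg }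
  have : Injective (ModuleCat.of R B) := Module.injective_object_of_injective_module R B
  exact hS.hasInjectiveDimensionLT_X₁ n hC
    (hasInjectiveDimensionLT_of_ge (ModuleCat.of R B) 1 (n + 1) (by lia))

variable {Λ : Type u} [Ring Λ]

lemma hasInjectiveDimensionLT_homDual (M : ModuleCat.{u} Λ) (d : ℕ) (Y : ModuleCat.{u} Λ)
    (h : MDimLE Λ M d Y) :
    HasInjectiveDimensionLT (ModuleCat.of (Module.End Λ M) (CharacterModule (M →ₗ[Λ] Y)))
      (d + 1) := by
  induction d generalizing Y with
  | zero =>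
    have := injective_homDual_of_inAdd (M := M) (Y := Y) h
    have : Injective (ModuleCat.of (Module.End Λ M) (CharacterModule (M →ₗ[Λ] Y))) :=
      Module.injective_object_of_injective_module _ _
    infer_instance
  | succ d ih =>
    obtain ⟨M', g, ⟨⟨hM', hg⟩, -⟩, hk⟩ := h
    exact hasInjectiveDimensionLT_of_exact (homDualMap M g)
      (homDualMap M (LinearMap.ker g).subtype) (homDualMap_injective g hg) (homDualMap_exact g)
      (homDualMap_surjective _ (Submodule.subtype_injective _)) (injective_homDual_of_inAdd hM')
      (d + 1) (ih _ hk)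

lemma hasInjectiveDimensionLT_ker_homDualMap (M : ModuleCat.{u} Λ) (d : ℕ)
    {A B : Type u} [AddCommGroup A] [Module Λ A] [AddCommGroup B] [Module Λ B]
    (hA : InAdd Λ M A) (hB : InAdd Λ M B) (f : A →ₗ[Λ] B)
    (h : MDimLE Λ M d (ModuleCat.of Λ (LinearMap.ker f))) :
    HasInjectiveDimensionLT (ModuleCat.of (Module.End Λ M) (LinearMap.ker (homDualMap M f)))
      (d + 3) := by
  refine hasInjectiveDimensionLT_of_exact (Submodule.subtype _)
    (homDualMap M f).rangeRestrict (Submodule.subtype_injective _) ?_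
    (LinearMap.surjective_rangeRestrict _) (injective_homDual_of_inAdd hB) (d + 2) ?_
  · rw [LinearMap.exact_iff, LinearMap.ker_rangeRestrict, Submodule.range_subtype]
  refine hasInjectiveDimensionLT_of_exact (Submodule.subtype _)
    (homDualMap M (LinearMap.ker f).subtype) (Submodule.subtype_injective _) ?_
    (homDualMap_surjective _ (Submodule.subtype_injective _)) (injective_homDual_of_inAdd hA)
    (d + 1) (hasInjectiveDimensionLT_homDual M d _ h)
  rw [LinearMap.exact_iff, Submodule.range_subtype]
  exact LinearMap.exact_iff.1 (homDualMap_exact f)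

end InjectiveDimension

section Syzygy

variable {Λ : Type u} [Ring Λ]

/-- A submodule `K` of a free module of finite rank over `End M`, generated by the rows of a
matrix `A`, is a direct summand as soon as every map from `K` into the dual of the transpose
of `A` extends. -/
lemma exists_retraction {M : Type u} [AddCommGroup M] [Module Λ M] {n m : ℕ}
    (K : Submodule (Module.End Λ M) (Fin n → Module.End Λ M))
    (x : Fin m → K) (hx : Submodule.span (Module.End Λ M) (Set.range x) = ⊤)
    (h : ∀ φ : K →ₗ[Module.End Λ M] LinearMap.ker (homDualMap M
        (LinearMap.pi fun i ↦ ∑ j, (x i).1 j ∘ₗ LinearMap.proj j :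
          (Fin n → M) →ₗ[Λ] (Fin m → M))),
      ∃ Φ, Φ ∘ₗ K.subtype = φ) :
    ∃ ρ : (Fin n → Module.End Λ M) →ₗ[Module.End Λ M] K, ρ ∘ₗ K.subtype = LinearMap.id := by
  classical
  set f : (Fin n → M) →ₗ[Λ] (Fin m → M) :=
    LinearMap.pi fun i ↦ ∑ j, (x i).1 j ∘ₗ LinearMap.proj j with hf
  let p : (Fin n → K) →+ (Fin m → K) :=
    AddMonoidHom.mk' (fun y i ↦ ∑ j, (x i).1 j • y j) fun y z ↦ by
      ext1 i
      simp [smul_add, Finset.sum_add_distrib]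
  obtain ⟨y, hy⟩ : ∃ y, p y = x := by
    refine exists_eq_of_forall_character p x fun χ hχ ↦ ?_
    let φ₀ : K →ₗ[Module.End Λ M] CharacterModule (M →ₗ[Λ] (Fin m → M)) :=
      { toFun := fun y ↦ AddMonoidHom.mk'
          (fun r ↦ χ fun i ↦ (LinearMap.proj i ∘ₗ r : Module.End Λ M) • y) fun r s ↦ by
            rw [← map_add]
            congr 1
        map_add' := fun y z ↦ by
          ext r
          change χ _ = χ _ + χ _
          rw [← map_add]
          congr 1
          ext1 i
          simp only [smul_add, Pi.add_apply]
        map_smul' := fun e y ↦ by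
          ext r
          change χ _ = χ _
          congr 1 }
    have hφ₀ : ∀ y r, φ₀ y r = χ fun i ↦ (LinearMap.proj i ∘ₗ r : Module.End Λ M) • y :=
      fun _ _ ↦ rfl
    obtain ⟨Φ, hΦ⟩ := h (φ₀.codRestrict _ fun y ↦ by
      rw [LinearMap.mem_ker]
      ext ψ
      rw [homDualMap_apply, hφ₀]
      refine Eq.trans ?_ (hχ fun j ↦ (LinearMap.proj j ∘ₗ ψ : Module.End Λ M) • y)
      congr 1
      ext1 i
      change _ = ∑ j, (x i).1 j • (LinearMap.proj j ∘ₗ ψ : Module.End Λ M) • y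
      simp only [smul_smul, ← Finset.sum_smul]
      congr 1
      ext m
      simp [hf])
    have hΦ' : ∀ (y : K) r, (Φ y.1).1 r = φ₀ y r := fun y r ↦ by
      have := LinearMap.congr_fun hΦ y
      exact congrArg (fun z ↦ z.1 r) this
    have h1 : χ x = ∑ i, φ₀ (x i) (LinearMap.single Λ (fun _ ↦ M) i) := by
      rw [← Finset.univ_sum_single x, map_sum]
      refine Finset.sum_congr rfl fun i _ ↦ ?_
      rw [hφ₀, Finset.univ_sum_single x]
      congr 1
      ext1 i'
      by_cases hi : i' = i
      · subst hi
        have : (LinearMap.proj i' ∘ₗ LinearMap.single Λ (fun _ ↦ M) i' : Module.End Λ M) = 1 := by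
          ext; simp
        simp [this]
      · have : (LinearMap.proj i' ∘ₗ LinearMap.single Λ (fun _ ↦ M) i : Module.End Λ M) = 0 := by
          ext; simp [hi]
        simp [this, hi]
    have h2 : ∀ i, φ₀ (x i) (LinearMap.single Λ (fun _ ↦ M) i) =
        ∑ j, (Φ (Pi.single j 1)).1 (LinearMap.single Λ (fun _ ↦ M) i ∘ₗ (x i).1 j) := fun i ↦ by
      have e : (x i).1 = ∑ j, (x i).1 j • Pi.single j (1 : Module.End Λ M) := by
        ext1 j
        simp [Finset.sum_apply, Pi.single_apply]
      rw [← hΦ']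
      conv_lhs => rw [e]
      have : ∀ (s : Fin n → LinearMap.ker (homDualMap M f)) (r : M →ₗ[Λ] (Fin m → M)),
          (∑ j, s j).1 r = ∑ j, (s j).1 r := fun s r ↦ by
        let ev : LinearMap.ker (homDualMap M f) →+ AddCircle (1 : ℚ) :=
          AddMonoidHom.mk' (fun z ↦ z.1 r) fun _ _ ↦ rfl
        exact map_sum ev s _
      rw [map_sum, this]
      refine Finset.sum_congr rfl fun j _ ↦ ?_
      rw [map_smul]
      rfl
    rw [h1, Finset.sum_congr rfl fun i _ ↦ h2 i, Finset.sum_comm]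
    refine Finset.sum_eq_zero fun j _ ↦ ?_
    rw [← map_sum]
    have h3 : ∑ i, LinearMap.single Λ (fun _ ↦ M) i ∘ₗ (x i).1 j =
        f ∘ₗ LinearMap.single Λ (fun _ ↦ M) j := by
      ext m i
      simp [hf, Finset.sum_apply, Pi.single_apply, apply_ite]
    rw [h3]
    exact DFunLike.congr_fun (Φ (Pi.single j 1)).2 _
  refine ⟨Fintype.linearCombination (Module.End Λ M) y, LinearMap.ext_on_range hx fun i ↦ ?_⟩
  exact congrFun hy i

open Abelian in
/-- Vanishing of `Ext¹(N, Y)` lets maps into `Y` extend along the kernel of a surjection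
onto `N`. -/
lemma exists_extension_of_ext_one {R : Type u} [Ring R] {P N Y : Type u} [AddCommGroup P]
    [Module R P] [AddCommGroup N] [Module R N] [AddCommGroup Y] [Module R Y]
    (q : P →ₗ[R] N) (hq : Function.Surjective q)
    (hE : Subsingleton (Ext (ModuleCat.of R N) (ModuleCat.of R Y) 1))
    (φ : LinearMap.ker q →ₗ[R] Y) : ∃ Φ : P →ₗ[R] Y, Φ ∘ₗ (LinearMap.ker q).subtype = φ := by
  have hS := LinearMap.shortExact_shortComplexKer hq
  obtain ⟨z, hz⟩ := Ext.contravariant_sequence_exact₁ hS (ModuleCat.of R Y)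
    (Ext.mk₀ (ModuleCat.ofHom φ)) (add_zero 1) (hE.elim _ _)
  obtain ⟨Φ, rfl⟩ := Ext.homEquiv₀.symm.surjective z
  rw [Ext.homEquiv₀_symm_apply, Ext.mk₀_comp_mk₀] at hz
  have := Ext.homEquiv₀.symm.injective hz
  exact ⟨Φ.hom, congrArg ModuleCat.Hom.hom this⟩

lemma Module.Projective.of_ker_retraction {R : Type*} [Ring R] {P N : Type*} [AddCommGroup P]
    [Module R P] [AddCommGroup N] [Module R N] [Module.Projective R P] (q : P →ₗ[R] N)
    (hq : Function.Surjective q) (ρ : P →ₗ[R] LinearMap.ker q)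
    (hρ : ρ ∘ₗ (LinearMap.ker q).subtype = LinearMap.id) : Module.Projective R N := by
  let s : N →ₗ[R] P :=
    (LinearMap.ker q).liftQ (LinearMap.id - (LinearMap.ker q).subtype ∘ₗ ρ) (fun x hx ↦ by
      have := LinearMap.congr_fun hρ ⟨x, hx⟩
      simp only [LinearMap.comp_apply, Submodule.subtype_apply, LinearMap.id_apply] at this
      simp [this]) ∘ₗ (q.quotKerEquivOfSurjective hq).symm.toLinearMap
  refine Module.Projective.of_split s q (LinearMap.ext fun v ↦ ?_)
  obtain ⟨x, rfl⟩ := hq v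
  have e : (q.quotKerEquivOfSurjective hq).symm (q x) = Submodule.Quotient.mk x := by
    rw [LinearEquiv.symm_apply_eq]
    rfl
  have : s (q x) = x - (ρ x).1 := by
    rw [LinearMap.comp_apply, LinearEquiv.coe_coe, e]
    rfl
  rw [LinearMap.comp_apply, this, map_sub, (ρ x).2]
  simp

open Abelian in
/-- Over a left Noetherian endomorphism ring, projective dimension of finitely generated modules
is detected by `Ext` into the kernels of the maps `homDualMap M f`, for `f` a matrix over
`End M`. -/
lemma projDimLE_of_ext_vanishing {M : Type u} [AddCommGroup M] [Module Λ M]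
    [IsNoetherianRing (Module.End Λ M)] (c : ℕ) (N : ModuleCat.{u} (Module.End Λ M))
    (hN : Module.Finite (Module.End Λ M) N)
    (hE : ∀ (n m : ℕ) (f : (Fin n → M) →ₗ[Λ] (Fin m → M)),
      Subsingleton (Ext N (ModuleCat.of (Module.End Λ M) (LinearMap.ker (homDualMap M f)))
        (c + 1))) :
    ProjDimLE (Module.End Λ M) c N := by
  induction c generalizing N with
  | zero =>
    obtain ⟨n, q, hq⟩ := Module.Finite.exists_fin' (Module.End Λ M) N
    obtain ⟨m, x, hx⟩ := Module.Finite.exists_fin (R := Module.End Λ M) (M := LinearMap.ker q)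
    obtain ⟨ρ, hρ⟩ := exists_retraction (LinearMap.ker q) x hx fun φ ↦
      exists_extension_of_ext_one q hq (hE _ _ _) φ
    exact Module.Projective.of_ker_retraction q hq ρ hρ
  | succ c ih =>
    obtain ⟨n, q, hq⟩ := Module.Finite.exists_fin' (Module.End Λ M) N
    refine ⟨ModuleCat.of _ (Fin n → Module.End Λ M), q, inferInstanceAs
      (Module.Projective (Module.End Λ M) (Fin n → Module.End Λ M)), inferInstanceAs
      (Module.Finite (Module.End Λ M) (Fin n → Module.End Λ M)), hq, ih _
      (inferInstanceAs (Module.Finite (Module.End Λ M) (LinearMap.ker q))) fun n' m f ↦ ?_⟩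
    have hS := LinearMap.shortExact_shortComplexKer hq
    have : Projective (ModuleCat.of (Module.End Λ M) (Fin n → Module.End Λ M)) :=
      (IsProjective.iff_projective _).1 inferInstance
    refine subsingleton_of_forall_eq 0 fun e ↦ ?_
    obtain ⟨z, rfl⟩ := Ext.contravariant_sequence_exact₁ hS _ e (n₁ := c + 1 + 1) (by lia)
      ((hE n' m f).elim _ _)
    have hz : z = 0 := Ext.eq_zero_of_projective (P := ModuleCat.of (Module.End Λ M)
      (Fin n → Module.End Λ M)) z
    rw [hz, Ext.comp_zero]

end Syzygy

/-- Endomorphism rings of finitely generated modules over an algebra that is module-finite over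
a commutative Noetherian ring are left Noetherian. -/
lemma isNoetherianRing_end (k : Type*) [CommRing k] [IsNoetherianRing k] (Λ : Type*) [Ring Λ]
    [Algebra k Λ] [Module.Finite k Λ] (M : Type*) [AddCommGroup M] [Module Λ M]
    [Module.Finite Λ M] : IsNoetherianRing (Module.End Λ M) := by
  let : Module k M := Module.compHom M (algebraMap k Λ)
  have : IsScalarTower k Λ M := IsScalarTower.of_algebraMap_smul fun _ _ ↦ rfl
  have : Module.Finite k M := Module.Finite.trans Λ M
  obtain ⟨n, s, hs⟩ := Module.Finite.exists_fin (R := Λ) (M := M)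
  let ev : Module.End Λ M →ₗ[k] (Fin n → M) :=
    { toFun := fun e j ↦ e (s j)
      map_add' := fun _ _ ↦ rfl
      map_smul' := fun _ _ ↦ rfl }
  have hev : Function.Injective ev := fun e₁ e₂ h ↦
    LinearMap.ext_on_range hs fun j ↦ congrFun h j
  have : IsNoetherian k (Module.End Λ M) := isNoetherian_of_injective ev hev
  exact isNoetherian_of_tower k this

lemma inAdd_pi (Λ : Type u) [Ring Λ] (M : Type u) [AddCommGroup M] [Module Λ M] (n : ℕ) :
    InAdd Λ M (Fin n → M) :=
  ⟨n, LinearMap.id, LinearMap.id, rfl⟩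

/-- Auslander's Lemma: if every module has `M`-dimension at most `d`, then the global
dimension of `End(M)` is at most `d + 2`. -/
theorem stmt1 (k : Type u) [CommRing k] [IsArtinianRing k]
    (Λ : Type u) [Ring Λ] [Algebra k Λ] [Module.Finite k Λ]
    (M : ModuleCat.{u} Λ) (hM : Module.Finite Λ M) (d : ℕ)
    (h : ∀ X : ModuleCat.{u} Λ, Module.Finite Λ X → MDimLE Λ M d X) :
    GlobalDimLE (Module.End Λ ↥M) (d + 2) := by
  have : IsNoetherianRing (Module.End Λ M) := isNoetherianRing_end k Λ M
  have : IsNoetherianRing Λ := isNoetherian_of_tower k inferInstance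
  intro N hN
  refine projDimLE_of_ext_vanishing (d + 2) N hN fun n m f ↦ ?_
  have := hasInjectiveDimensionLT_ker_homDualMap M d (inAdd_pi Λ M n) (inAdd_pi Λ M m) f
    (h _ (inferInstanceAs (Module.Finite Λ (LinearMap.ker f))))
  exact HasInjectiveDimensionLT.subsingleton _ (d + 3) (d + 3) le_rfl N
end

section
/- An artin algebra Λ is torsionless-finite if and only if the subcategory of modules cogenerated by the radical J = rad Λ is finite. -/
open CategoryTheory

universe u

section Helpers

variable {Λ : Type u} [Ring Λ]

/-- An indecomposable module has no nontrivial complemented submodules. -/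
lemma Indec.eq_bot_or_eq_bot_of_isCompl {N : Type u} [AddCommGroup N] [Module Λ N]
    (hN : Indec Λ N) {p q : Submodule Λ N} (h : IsCompl p q) : p = ⊥ ∨ q = ⊥ := by
  rcases hN.2 (p.projection q h) (Submodule.isIdempotentElem_projection h) with h0 | h1
  · left
    rw [← Submodule.range_projection h, h0, LinearMap.range_zero]
  · right
    rw [← Submodule.ker_projection h, h1]
    exact LinearMap.ker_id

/-- Fitting's lemma: an endomorphism of an indecomposable module of finite length is nilpotent
or invertible. -/
lemma Indec.isNilpotent_or_isUnit {N : Type u} [AddCommGroup N] [Module Λ N]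
    [IsArtinian Λ N] [IsNoetherian Λ N] (hN : Indec Λ N) (f : Module.End Λ N) :
    IsNilpotent f ∨ IsUnit f := by
  obtain ⟨m, hm⟩ := Filter.eventually_atTop.mp f.eventually_isCompl_ker_pow_range_pow
  rcases hN.eq_bot_or_eq_bot_of_isCompl (hm (m + 1) (by lia)) with h | h
  · right
    rw [LinearMap.ker_eq_bot, pow_succ, Module.End.mul_eq_comp, LinearMap.coe_comp] at h
    exact (Module.End.isUnit_iff f).2
      (IsArtinian.bijective_of_injective_endomorphism f h.of_comp)
  · left
    exact ⟨m + 1, LinearMap.range_eq_bot.mp h⟩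

/-- `N` is a retract of `M`, that is, isomorphic to a direct summand of `M`. -/
def IsRetract (Λ : Type u) [Ring Λ] (N M : Type u) [AddCommGroup N] [Module Λ N]
    [AddCommGroup M] [Module Λ M] : Prop :=
  ∃ (i : N →ₗ[Λ] M) (p : M →ₗ[Λ] N), p.comp i = LinearMap.id

/-- If an endomorphism of `N` that factors through `M` is invertible, then `N` is a retract
of `M`. -/
lemma IsRetract.of_isUnit_comp {N M : Type u} [AddCommGroup N] [Module Λ N]
    [AddCommGroup M] [Module Λ M] (i : N →ₗ[Λ] M) (p : M →ₗ[Λ] N)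
    (h : IsUnit (p.comp i : Module.End Λ N)) : IsRetract Λ N M := by
  obtain ⟨g, hg⟩ := h.exists_left_inv
  exact ⟨i, g.comp p, hg⟩

/-- A nonzero retract of an indecomposable module is isomorphic to it. -/
lemma IsRetract.nonempty_linearEquiv {N M : Type u} [AddCommGroup N] [Module Λ N]
    [AddCommGroup M] [Module Λ M] [Nontrivial N] (hM : Indec Λ M) (h : IsRetract Λ N M) :
    Nonempty (N ≃ₗ[Λ] M) := by
  obtain ⟨i, p, hip⟩ := h
  have hpi (x : N) : p (i x) = x := LinearMap.congr_fun hip x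
  rcases hM.2 (i.comp p) (by ext x; simp [hpi]) with h0 | h1
  · obtain ⟨x, hx⟩ := exists_ne (0 : N)
    have := LinearMap.congr_fun h0 (i x)
    simp only [LinearMap.comp_apply, hpi, LinearMap.zero_apply] at this
    exact absurd (by rw [← hpi x, this, map_zero]) hx
  · exact ⟨LinearEquiv.ofLinearMap i p h1 hip⟩

/-- A retract of a direct sum of two submodules which is indecomposable of finite length is
a retract of one of them. -/
lemma IsRetract.of_isCompl {N M : Type u} [AddCommGroup N] [Module Λ N]
    [AddCommGroup M] [Module Λ M] [IsArtinian Λ N] [IsNoetherian Λ N] (hN : Indec Λ N)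
    (h : IsRetract Λ N M) {A B : Submodule Λ M} (hAB : IsCompl A B) :
    IsRetract Λ N A ∨ IsRetract Λ N B := by
  obtain ⟨i, p, hip⟩ := h
  let a : Module.End Λ N := (p.comp A.subtype).comp ((A.projectionOnto B hAB).comp i)
  let b : Module.End Λ N := (p.comp B.subtype).comp ((B.projectionOnto A hAB.symm).comp i)
  have hab : b = 1 - a := by
    rw [eq_sub_iff_add_eq', ← show p.comp i = (1 : Module.End Λ N) from hip]
    ext x
    simp only [a, b, LinearMap.add_apply, LinearMap.comp_apply, Submodule.subtype_apply,
      ← map_add]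
    congr 1
    exact Submodule.projection_add_projection_eq_self hAB (i x)
  rcases hN.isNilpotent_or_isUnit a with ha | ha
  · exact .inr (.of_isUnit_comp _ _ (show IsUnit b from hab ▸ ha.isUnit_one_sub))
  · exact .inl (.of_isUnit_comp _ _ ha)

/-- Up to isomorphism, a module of finite length has only finitely many indecomposable direct
summands. -/
lemma exists_indec_retracts (M : Type u) [AddCommGroup M] [Module Λ M]
    [IsArtinian Λ M] [IsNoetherian Λ M] :
    ∃ (n : ℕ) (L : Fin n → ModuleCat.{u} Λ), ∀ N : ModuleCat.{u} Λ, Indec Λ N →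
      IsRetract Λ N M → ∃ j, Nonempty (N ≃ₗ[Λ] L j) := by
  induction h : Module.length Λ M using WellFoundedLT.induction generalizing M with
  | ind l ih =>
  subst h
  by_cases hM : Indec Λ M
  · refine ⟨1, fun _ => ModuleCat.of Λ M, fun N hN hr => ⟨0, ?_⟩⟩
    have := hN.1
    exact hr.nonempty_linearEquiv hM
  rcases subsingleton_or_nontrivial M with hs | hnt
  · refine ⟨0, Fin.elim0, fun N hN hr => ?_⟩
    obtain ⟨i, p, hip⟩ := hr
    have := hN.1
    have hi : Function.Injective i := Function.LeftInverse.injective (LinearMap.congr_fun hip)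
    exact absurd hi.subsingleton (not_subsingleton N)
  have : ∃ e : Module.End Λ M, IsIdempotentElem e ∧ e ≠ 0 ∧ e ≠ 1 := by
    by_contra! hc
    exact hM ⟨hnt, fun e he => or_iff_not_imp_left.2 (hc e he)⟩
  obtain ⟨e, he, he0, he1⟩ := this
  have hc : IsCompl (LinearMap.range e) (LinearMap.ker e) := LinearMap.IsIdempotentElem.isCompl he
  have hr : LinearMap.range e ≠ ⊤ := fun ht => he1 <| by
    have hk : LinearMap.ker e = ⊥ := by simpa [ht] using hc.disjoint
    ext x
    exact LinearMap.ker_eq_bot.1 hk (LinearMap.congr_fun he x)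
  have hk : LinearMap.ker e ≠ ⊤ := fun ht => he0 (LinearMap.ker_eq_top.1 ht)
  obtain ⟨m, L, hL⟩ := ih _ (Submodule.length_lt hr) (LinearMap.range e) rfl
  obtain ⟨n, K, hK⟩ := ih _ (Submodule.length_lt hk) (LinearMap.ker e) rfl
  refine ⟨m + n, Fin.append L K, fun N hN hret => ?_⟩
  have hinj : ∃ i : N →ₗ[Λ] M, Function.Injective i :=
    let ⟨i, p, hip⟩ := hret
    ⟨i, Function.LeftInverse.injective (LinearMap.congr_fun hip)⟩
  obtain ⟨i, hi⟩ := hinj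
  have := isArtinian_of_injective i hi
  have := isNoetherian_of_injective i hi
  rcases hret.of_isCompl hN hc with h | h
  · obtain ⟨j, hj⟩ := hL N hN h
    exact ⟨Fin.castAdd n j, by rwa [Fin.append_left]⟩
  · obtain ⟨j, hj⟩ := hK N hN h
    exact ⟨Fin.natAdd m j, by rwa [Fin.append_right]⟩

/-- An indecomposable module of finite length with a linear form not taking values in the
Jacobson radical is a direct summand of the ring. -/
lemma Indec.isRetract_of_apply_notMem_jacobson {N : Type u} [AddCommGroup N] [Module Λ N]
    [IsArtinian Λ N] [IsNoetherian Λ N] (hN : Indec Λ N) (f : N →ₗ[Λ] Λ) {x : N}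
    (hx : f x ∉ (⊥ : Ideal Λ).jacobson) : IsRetract Λ N Λ := by
  by_contra hret
  refine hx (Ideal.mem_jacobson_iff.2 fun y => ?_)
  let g : Module.End Λ N := (LinearMap.toSpanSingleton Λ N (y • x)).comp f
  have hg : IsNilpotent g :=
    (hN.isNilpotent_or_isUnit g).resolve_right fun h => hret (.of_isUnit_comp _ _ h)
  obtain ⟨m, hm⟩ := hg
  have hpow (m : ℕ) : y * f ((g ^ m) x) = (y * f x) ^ (m + 1) := by
    induction m with
    | zero => simp
    | succ m ih =>
      rw [pow_succ' g, pow_succ _ (m + 1), ← ih]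
      simp [g, mul_assoc]
  have hnil : IsNilpotent (y * f x) := ⟨m + 1, by rw [← hpow, hm]; simp⟩
  obtain ⟨z, hz⟩ := hnil.isUnit_one_add.exists_left_inv
  refine ⟨z, ?_⟩
  rw [Ideal.mem_bot, ← hz]
  noncomm_ring

end Helpers

/-- An artin algebra is torsionless-finite iff the subcategory of modules cogenerated by the
radical `J = rad Λ` is finite. -/
theorem stmt6 (k : Type u) [CommRing k] [IsArtinianRing k]
    (Λ : Type u) [Ring Λ] [Algebra k Λ] [Module.Finite k Λ] :
    TorsionlessFinite Λ ↔
      ∃ (n : ℕ) (L : Fin n → ModuleCat.{u} Λ),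
        ∀ N : ModuleCat.{u} Λ, Module.Finite Λ N → Indec Λ N →
          CogenBy Λ ↥((⊥ : Ideal Λ).jacobson) ↥N →
          ∃ i, Nonempty (N ≃ₗ[Λ] L i) := by
  have : IsArtinianRing Λ := IsArtinianRing.of_finite k Λ
  constructor
  · rintro ⟨n, L, hL⟩
    refine ⟨n, L, fun N hfin hN ⟨m, f, hf⟩ => hL N hfin ?_ hN⟩
    exact ⟨m, (LinearMap.compLeft ((⊥ : Ideal Λ).jacobson).subtype (Fin m)).comp f,
      (Subtype.val_injective.comp_left).comp hf⟩
  · rintro ⟨n, L, hL⟩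
    obtain ⟨m, K, hK⟩ := exists_indec_retracts (Λ := Λ) Λ
    refine ⟨n + m, Fin.append L K, fun N hfin ⟨r, f, hf⟩ hN => ?_⟩
    by_cases hJ : ∀ x j, f x j ∈ (⊥ : Ideal Λ).jacobson
    · obtain ⟨i, hi⟩ := hL N hfin hN
        ⟨r, LinearMap.pi fun j => ((LinearMap.proj j).comp f).codRestrict _ (hJ · j),
          fun x y hxy => hf <| funext fun j => congrArg Subtype.val (congrFun hxy j)⟩
      exact ⟨Fin.castAdd m i, by rwa [Fin.append_left]⟩
    · push Not at hJ
      obtain ⟨x, j, hx⟩ := hJ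
      obtain ⟨i, hi⟩ := hK N hN
        (hN.isRetract_of_apply_notMem_jacobson ((LinearMap.proj j).comp f) hx)
      exact ⟨Fin.natAdd n i, by rwa [Fin.append_right]⟩
end
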